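/- Let K be a field of characteristic zero, let α and β be nonzero elements of K, and let a, b, c, d be positive integers with a·d > b·c. Let I be the ideal of the polynomial ring K[x, y] generated by the two binomials x^a − α·y^b and x^c − β·y^d. Then the quotient ring K[x, y]/I is a finite-dimensional K-vector space of dimension exactly a·d. -/

import Mathlib

open MvPolynomial

/-- The normal form of the monomial `x ^ i * y ^ j` under the rewriting rules `x ^ a ↦ α * y ^ b` and
`y ^ d ↦ β⁻¹ * x ^ c`, in coordinates with respect to the monomials `x ^ i * y ^ j` with `i < a` and
`j < d`. Both rules decrease the weight `(b + d) * i + (a + c) * j`. -/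
noncomputable def binomialNormalForm {K : Type*} [Field K] (α β : K) {a b c d : ℕ}
    (h : b * c < a * d) (i j : ℕ) : Fin a × Fin d →₀ K :=
  if hi : i < a then
    if hj : j < d then Finsupp.single (⟨i, hi⟩, ⟨j, hj⟩) 1
    else β⁻¹ • binomialNormalForm α β h (i + c) (j - d)
  else α • binomialNormalForm α β h (i - a) (j + b)
termination_by (b + d) * i + (a + c) * j
decreasing_by
  · obtain ⟨k, rfl⟩ := Nat.exists_eq_add_of_le (not_lt.mp hj)
    rw [Nat.add_sub_cancel_left]
    nlinarith
  · obtain ⟨k, rfl⟩ := Nat.exists_eq_add_of_le (not_lt.mp hi)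
    rw [Nat.add_sub_cancel_left]
    nlinarith

section BinomialNormalForm

variable {K : Type*} [Field K] (α β : K) {a b c d : ℕ} (h : b * c < a * d)

theorem binomialNormalForm_of_lt (i : Fin a) (j : Fin d) :
    binomialNormalForm α β h i j = Finsupp.single (i, j) 1 := by
  rw [binomialNormalForm]
  simp

theorem binomialNormalForm_add_left (i j : ℕ) :
    binomialNormalForm α β h (i + a) j = α • binomialNormalForm α β h i (j + b) := by
  rw [binomialNormalForm]
  simp

theorem binomialNormalForm_add_right (i j : ℕ) :
    binomialNormalForm α β h i (j + d) = β⁻¹ • binomialNormalForm α β h (i + c) j := by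
  by_cases hi : i < a
  · rw [binomialNormalForm]
    simp [hi]
  · obtain ⟨k, rfl⟩ := Nat.exists_eq_add_of_le' (not_lt.mp hi)
    rw [binomialNormalForm_add_left, add_right_comm j d b, add_right_comm k a c,
      binomialNormalForm_add_left, binomialNormalForm_add_right k (j + b), smul_comm]
termination_by (b + d) * i + (a + c) * j
decreasing_by
  subst_vars
  nlinarith

/-- The `K`-linear map sending each polynomial in two variables to its normal form. -/
noncomputable def binomialReduction : MvPolynomial (Fin 2) K →ₗ[K] (Fin a × Fin d →₀ K) :=
  (basisMonomials (Fin 2) K).constr K fun m ↦ binomialNormalForm α β h (m 0) (m 1)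

theorem binomialReduction_monomial (m : Fin 2 →₀ ℕ) (r : K) :
    binomialReduction α β h (monomial m r) = r • binomialNormalForm α β h (m 0) (m 1) := by
  have hm : monomial m r = r • basisMonomials (Fin 2) K m := by
    simp [smul_monomial]
  rw [hm, map_smul, binomialReduction, Module.Basis.constr_basis]

theorem monomial_mul_X_pow_sub (m : Fin 2 →₀ ℕ) (s t : Fin 2) (k l : ℕ) (r γ : K) :
    monomial m r * (X s ^ k - C γ * X t ^ l) =
      monomial (m + Finsupp.single s k) r - monomial (m + Finsupp.single t l) (r * γ) := by
  rw [X_pow_eq_monomial, X_pow_eq_monomial, C_mul_monomial, mul_sub, monomial_mul, monomial_mul]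
  simp

theorem binomialReduction_eq_zero (hβ : β ≠ 0) {p : MvPolynomial (Fin 2) K}
    (hp : p ∈ Ideal.span {(X 0 : MvPolynomial (Fin 2) K) ^ a - C α * (X 1) ^ b,
      (X 0 : MvPolynomial (Fin 2) K) ^ c - C β * (X 1) ^ d}) :
    binomialReduction α β h p = 0 := by
  obtain ⟨u, v, rfl⟩ := Ideal.mem_span_pair.mp hp
  clear hp
  rw [map_add]
  convert add_zero (0 : Fin a × Fin d →₀ K)
  · induction u using MvPolynomial.induction_on' with
    | monomial m r =>
      rw [monomial_mul_X_pow_sub, map_sub, binomialReduction_monomial, binomialReduction_monomial]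
      simp [binomialNormalForm_add_left, mul_smul]
    | add p q hp hq =>
      rw [add_mul, map_add, hp, hq, add_zero]
  · induction v using MvPolynomial.induction_on' with
    | monomial m r =>
      rw [monomial_mul_X_pow_sub, map_sub, binomialReduction_monomial, binomialReduction_monomial]
      simp [binomialNormalForm_add_right, mul_smul, smul_inv_smul₀ hβ]
    | add p q hp hq =>
      rw [add_mul, map_add, hp, hq, add_zero]

theorem linearCombination_binomialNormalForm {A : Type*} [CommRing A] [Algebra K A] (hβ : β ≠ 0)
    {x y : A} (hx : x ^ a = α • y ^ b) (hy : x ^ c = β • y ^ d) (i j : ℕ) :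
    Finsupp.linearCombination K (fun k : Fin a × Fin d ↦ x ^ (k.1 : ℕ) * y ^ (k.2 : ℕ))
      (binomialNormalForm α β h i j) = x ^ i * y ^ j := by
  fun_induction binomialNormalForm α β h i j with
  | case1 i j hi hj => simp
  | case2 i j hi hj ih =>
    rw [map_smul, ih, pow_add, hy, mul_smul_comm, smul_mul_assoc, inv_smul_smul₀ hβ, mul_assoc,
      ← pow_add, Nat.add_sub_cancel' (not_lt.mp hj)]
  | case3 i j hi ih =>
    rw [map_smul, ih, pow_add, mul_comm (y ^ j), ← mul_smul_comm, ← smul_mul_assoc, ← hx, ← mul_assoc,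
      ← pow_add, Nat.sub_add_cancel (not_lt.mp hi)]

/-- The quotient of `K[x, y]` by `x ^ a - α * y ^ b` and `x ^ c - β * y ^ d` has the monomials
`x ^ i * y ^ j` with `i < a` and `j < d` as a basis. -/
noncomputable def binomialQuotientEquiv (hβ : β ≠ 0) :
    (MvPolynomial (Fin 2) K ⧸
      Ideal.span {(X 0 : MvPolynomial (Fin 2) K) ^ a - C α * (X 1) ^ b,
        (X 0 : MvPolynomial (Fin 2) K) ^ c - C β * (X 1) ^ d}) ≃ₗ[K] (Fin a × Fin d →₀ K) :=
  let I := Ideal.span {(X 0 : MvPolynomial (Fin 2) K) ^ a - C α * (X 1) ^ b,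
    (X 0 : MvPolynomial (Fin 2) K) ^ c - C β * (X 1) ^ d}
  let x : MvPolynomial (Fin 2) K ⧸ I := Ideal.Quotient.mk I (X 0)
  let y : MvPolynomial (Fin 2) K ⧸ I := Ideal.Quotient.mk I (X 1)
  LinearEquiv.ofLinearMap
    ((I.restrictScalars K).liftQ (binomialReduction α β h)
      fun _ hp ↦ binomialReduction_eq_zero α β h hβ hp)
    (Finsupp.linearCombination K fun k : Fin a × Fin d ↦ x ^ (k.1 : ℕ) * y ^ (k.2 : ℕ))
    (by
      ext1 ⟨i, j⟩
      ext1
      have hij : Finsupp.linearCombination K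
          (fun k : Fin a × Fin d ↦ x ^ (k.1 : ℕ) * y ^ (k.2 : ℕ)) (Finsupp.single (i, j) 1) =
          Ideal.Quotient.mk I
            (monomial (Finsupp.single 0 (i : ℕ) + Finsupp.single 1 (j : ℕ)) 1) := by
        simp [x, y, X_pow_eq_monomial, ← map_pow, ← map_mul, monomial_mul]
      refine (congrArg _ hij).trans ((binomialReduction_monomial α β h _ _).trans ?_)
      simp [binomialNormalForm_of_lt])
    (by
      have hx : x ^ a = α • y ^ b := by
        change Ideal.Quotient.mk I (X 0 ^ a) = Ideal.Quotient.mk I (α • X 1 ^ b)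
        rw [Ideal.Quotient.eq, smul_eq_C_mul]
        exact Ideal.subset_span (Set.mem_insert _ _)
      have hy : x ^ c = β • y ^ d := by
        change Ideal.Quotient.mk I (X 0 ^ c) = Ideal.Quotient.mk I (β • X 1 ^ d)
        rw [Ideal.Quotient.eq, smul_eq_C_mul]
        exact Ideal.subset_span (Set.mem_insert_of_mem _ rfl)
      refine LinearMap.ext fun q ↦ ?_
      obtain ⟨p, rfl⟩ := Ideal.Quotient.mk_surjective q
      change Finsupp.linearCombination K _ (binomialReduction α β h p) = Ideal.Quotient.mk I p
      induction p using MvPolynomial.induction_on' with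
      | monomial m r =>
        rw [binomialReduction_monomial, map_smul,
          linearCombination_binomialNormalForm α β h hβ hx hy, monomial_eq, ← smul_eq_C_mul]
        change _ = r • Ideal.Quotient.mk I _
        simp [x, y, Finsupp.prod_fintype]
      | add p q hp hq => rw [map_add, map_add, map_add, hp, hq])

end BinomialNormalForm

/-- Let `K` be a field of characteristic zero, `α, β` nonzero elements of `K`, and
`a, b, c, d` positive integers with `a·d > b·c`.  Let `I` be the ideal of `K[x,y]`
generated by `x^a − α·y^b` and `x^c − β·y^d`.  Then `K[x,y]/I` is a finite-dimensional
`K`-vector space of dimension exactly `a·d`. -/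
theorem quotient_finrank_eq (K : Type*) [Field K] [CharZero K]
    (α β : K) (hα : α ≠ 0) (hβ : β ≠ 0)
    (a b c d : ℕ) (ha : 0 < a) (hb : 0 < b) (hc : 0 < c) (hd : 0 < d)
    (habcd : b * c < a * d) :
    FiniteDimensional K (MvPolynomial (Fin 2) K ⧸
      Ideal.span {(X 0 : MvPolynomial (Fin 2) K) ^ a - C α * (X 1) ^ b,
        (X 0 : MvPolynomial (Fin 2) K) ^ c - C β * (X 1) ^ d}) ∧
    Module.finrank K (MvPolynomial (Fin 2) K ⧸
      Ideal.span {(X 0 : MvPolynomial (Fin 2) K) ^ a - C α * (X 1) ^ b,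
        (X 0 : MvPolynomial (Fin 2) K) ^ c - C β * (X 1) ^ d}) = a * d := by
  have e := binomialQuotientEquiv α β habcd hβ
  exact ⟨Module.Finite.equiv e.symm, by rw [e.finrank_eq]; simp⟩
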